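/- arXiv:0802.1414 — 2 statements merged into one kernel-verified Lean document; each statement's English description precedes it below -/
import Mathlib

section
/- For every h>0, every r>0 and every real z with z<h one has ∫₀^∞ e^{zt} p_h(r,t) dt ≥ exp(−h·r²/4) · ∫₀^∞ e^{(z−h)t} p_0(r,t) dt (both integrals converging absolutely). In terms of Green functions this says |G_h(x,y;z)| ≥ G_0(x,y;z−h)·exp(−h|x−y|²/4) for x≠y. -/
open MeasureTheory Real Set

/-- Modulus of the Landau heat kernel at distance `r`. -/
noncomputable def landauHeatKernel (h r t : ℝ) : ℝ :=
  h / (4 * π * Real.sinh (h * t)) *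
    Real.exp (-(h * r ^ 2 * (Real.cosh (h * t) / Real.sinh (h * t))) / 4)

/-- Free heat kernel on `ℝ²` at distance `r`. -/
noncomputable def freeHeatKernel (r t : ℝ) : ℝ :=
  1 / (4 * π * t) * Real.exp (-(r ^ 2) / (4 * t))

theorem mul_exp_neg_mul_le_inv {a : ℝ} (ha : 0 < a) (u : ℝ) : u * Real.exp (-(a * u)) ≤ a⁻¹ := by
  have h1 : a * u ≤ Real.exp (a * u) := by linarith [Real.add_one_le_exp (a * u)]
  rw [Real.exp_neg, ← div_eq_mul_inv, div_le_iff₀ (Real.exp_pos _), inv_mul_eq_div, le_div_iff₀ ha]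
  linarith

theorem sinh_le_mul_exp (s : ℝ) : Real.sinh s ≤ s * Real.exp s := by
  have h1 : 1 - 2 * s ≤ Real.exp (-s) * Real.exp (-s) := by
    rw [← Real.exp_add]
    linarith [Real.add_one_le_exp (-s + -s)]
  have h2 : Real.exp (-s) * Real.exp s = 1 := by rw [← Real.exp_add]; simp
  have h3 := mul_le_mul_of_nonneg_right h1 (Real.exp_pos s).le
  rw [mul_assoc, h2] at h3
  rw [Real.sinh_eq]
  linarith

theorem cosh_div_sinh_le {s : ℝ} (hs : 0 < s) : Real.cosh s / Real.sinh s ≤ 1 + 1 / s := by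
  have hsinh : 0 < Real.sinh s := Real.sinh_pos_iff.mpr hs
  have h1 : s * Real.exp (-s) ≤ Real.sinh s := by
    have h2 : 1 + 2 * s ≤ Real.exp s * Real.exp s := by
      rw [← Real.exp_add]
      linarith [Real.add_one_le_exp (s + s)]
    have h3 : Real.exp s * Real.exp (-s) = 1 := by rw [← Real.exp_add]; simp
    have h4 := mul_le_mul_of_nonneg_right h2 (Real.exp_pos (-s)).le
    rw [mul_assoc, h3] at h4
    rw [Real.sinh_eq]
    linarith
  have h5 := Real.cosh_sub_sinh s
  rw [div_le_iff₀ hsinh, ← mul_le_mul_iff_right₀ hs]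
  have h6 : s * ((1 + 1 / s) * Real.sinh s) = s * Real.sinh s + Real.sinh s := by
    field_simp
  rw [h6]
  rw [← h5] at h1
  linarith

theorem freeHeatKernel_nonneg {r t : ℝ} (ht : 0 < t) : 0 ≤ freeHeatKernel r t := by
  unfold freeHeatKernel
  positivity

theorem landauHeatKernel_nonneg {h r t : ℝ} (hh : 0 < h) (ht : 0 < t) :
    0 ≤ landauHeatKernel h r t := by
  have hsinh : 0 < Real.sinh (h * t) := Real.sinh_pos_iff.mpr (mul_pos hh ht)
  unfold landauHeatKernel
  positivity

theorem freeHeatKernel_le {r : ℝ} (hr : 0 < r) (t : ℝ) :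
    freeHeatKernel r t ≤ (4 * π)⁻¹ * (r ^ 2 / 4)⁻¹ := by
  have h1 := mul_exp_neg_mul_le_inv (a := r ^ 2 / 4) (by positivity) (1 / t)
  have h2 : freeHeatKernel r t
      = (4 * π)⁻¹ * (1 / t * Real.exp (-(r ^ 2 / 4 * (1 / t)))) := by
    have h3 : -(r ^ 2) / (4 * t) = -(r ^ 2 / 4 * (1 / t)) := by ring
    rw [freeHeatKernel, h3]
    ring
  rw [h2]
  gcongr

theorem landauHeatKernel_le {h r t : ℝ} (hh : 0 < h) (hr : 0 < r) (ht : 0 < t) :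
    landauHeatKernel h r t
      ≤ h / (4 * π) * (2 * (h * r ^ 2 / 4)⁻¹) * Real.exp (-(h * t)) := by
  have hsinh : 0 < Real.sinh (h * t) := Real.sinh_pos_iff.mpr (mul_pos hh ht)
  have hcosh := Real.cosh_pos (h * t)
  have h1 := mul_exp_neg_mul_le_inv (a := h * r ^ 2 / 4) (by positivity)
    (Real.cosh (h * t) / Real.sinh (h * t))
  have h2 : landauHeatKernel h r t = h / (4 * π) * ((Real.cosh (h * t) / Real.sinh (h * t) *
      Real.exp (-(h * r ^ 2 / 4 * (Real.cosh (h * t) / Real.sinh (h * t))))) *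
        (Real.cosh (h * t))⁻¹) := by
    have h3 : -(h * r ^ 2 * (Real.cosh (h * t) / Real.sinh (h * t))) / 4
        = -(h * r ^ 2 / 4 * (Real.cosh (h * t) / Real.sinh (h * t))) := by ring
    rw [landauHeatKernel, h3]
    field_simp
  have h4 : (Real.cosh (h * t))⁻¹ ≤ 2 * Real.exp (-(h * t)) := by
    have h5 : Real.exp (h * t) / 2 ≤ Real.cosh (h * t) := by
      rw [Real.cosh_eq]
      linarith [Real.exp_pos (-(h * t))]
    calc (Real.cosh (h * t))⁻¹ ≤ (Real.exp (h * t) / 2)⁻¹ := by gcongr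
      _ = 2 * Real.exp (-(h * t)) := by rw [Real.exp_neg, inv_div, div_eq_mul_inv]
  calc landauHeatKernel h r t
      ≤ h / (4 * π) * ((h * r ^ 2 / 4)⁻¹ * (2 * Real.exp (-(h * t)))) := by
        rw [h2]
        gcongr
    _ = _ := by ring

/-- Pointwise comparison of the Landau and free heat kernels. -/
theorem exp_mul_freeHeatKernel_le_landauHeatKernel {h t : ℝ} (r : ℝ) (hh : 0 < h) (ht : 0 < t) :
    Real.exp (-(h * r ^ 2) / 4) * (Real.exp (-(h * t)) * freeHeatKernel r t)
      ≤ landauHeatKernel h r t := by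
  have hs : 0 < h * t := mul_pos hh ht
  have hsinh : 0 < Real.sinh (h * t) := Real.sinh_pos_iff.mpr hs
  have h1 : Real.exp (-(h * t)) * (1 / (4 * π * t)) ≤ h / (4 * π * Real.sinh (h * t)) := by
    rw [Real.exp_neg, inv_mul_eq_div, div_div, div_le_div_iff₀ (by positivity) (by positivity)]
    have h2 := mul_le_mul_of_nonneg_left (sinh_le_mul_exp (h * t)) (by positivity : 0 ≤ 4 * π)
    linarith
  have h3 : -(h * r ^ 2) / 4 + -(r ^ 2) / (4 * t)
      ≤ -(h * r ^ 2 * (Real.cosh (h * t) / Real.sinh (h * t))) / 4 := by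
    have h4 := mul_le_mul_of_nonneg_left (cosh_div_sinh_le hs) (by positivity : 0 ≤ h * r ^ 2)
    have h5 : h * r ^ 2 * (1 + 1 / (h * t)) = h * r ^ 2 + 4 * (r ^ 2 / (4 * t)) := by
      field_simp
    rw [h5] at h4
    rw [neg_div _ (r ^ 2)]
    linarith
  calc Real.exp (-(h * r ^ 2) / 4) * (Real.exp (-(h * t)) * freeHeatKernel r t)
      = Real.exp (-(h * t)) * (1 / (4 * π * t))
          * Real.exp (-(h * r ^ 2) / 4 + -(r ^ 2) / (4 * t)) := by
        rw [freeHeatKernel, Real.exp_add]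
        ring
    _ ≤ landauHeatKernel h r t := by
        rw [landauHeatKernel]
        gcongr

theorem integrableOn_exp_mul_freeHeatKernel {r w : ℝ} (hr : 0 < r) (hw : w < 0) :
    IntegrableOn (fun t : ℝ => Real.exp (w * t) * freeHeatKernel r t) (Ioi 0) := by
  refine ((integrableOn_exp_mul_Ioi hw 0).mul_const ((4 * π)⁻¹ * (r ^ 2 / 4)⁻¹)).mono' ?_ ?_
  · unfold freeHeatKernel
    exact Measurable.aestronglyMeasurable (by fun_prop)
  · filter_upwards [ae_restrict_mem measurableSet_Ioi] with t ht
    rw [Real.norm_of_nonneg (mul_nonneg (Real.exp_pos _).le (freeHeatKernel_nonneg ht))]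
    gcongr
    exact freeHeatKernel_le hr t

theorem integrableOn_exp_mul_landauHeatKernel {h r z : ℝ} (hh : 0 < h) (hr : 0 < r) (hz : z < h) :
    IntegrableOn (fun t : ℝ => Real.exp (z * t) * landauHeatKernel h r t) (Ioi 0) := by
  refine ((integrableOn_exp_mul_Ioi (sub_neg.mpr hz) 0).const_mul
    (h / (4 * π) * (2 * (h * r ^ 2 / 4)⁻¹))).mono' ?_ ?_
  · unfold landauHeatKernel
    exact Measurable.aestronglyMeasurable (by fun_prop)
  · filter_upwards [ae_restrict_mem measurableSet_Ioi] with t ht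
    rw [Real.norm_of_nonneg (mul_nonneg (Real.exp_pos _).le (landauHeatKernel_nonneg hh ht))]
    have h1 : Real.exp ((z - h) * t) = Real.exp (z * t) * Real.exp (-(h * t)) := by
      rw [← Real.exp_add]
      ring_nf
    calc Real.exp (z * t) * landauHeatKernel h r t
        ≤ Real.exp (z * t) *
          (h / (4 * π) * (2 * (h * r ^ 2 / 4)⁻¹) * Real.exp (-(h * t))) := by
          gcongr
          exact landauHeatKernel_le hh hr ht
      _ = _ := by rw [h1]; ring

/-- For `h>0`, `r>0` and real `z<h`:
`∫₀^∞ e^{zt} p_h(r,t) dt ≥ exp(−h r²/4) ∫₀^∞ e^{(z−h)t} p_0(r,t) dt`,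
both integrals converging absolutely.  In Green-function terms:
`|G_h(x,y;z)| ≥ G_0(x,y;z−h) exp(−h|x−y|²/4)`. -/
theorem landau_green_lower_bound (h r z : ℝ) (hh : 0 < h) (hr : 0 < r) (hz : z < h) :
    IntegrableOn (fun t : ℝ => Real.exp (z * t) * landauHeatKernel h r t) (Ioi 0) ∧
    IntegrableOn (fun t : ℝ => Real.exp ((z - h) * t) * freeHeatKernel r t) (Ioi 0) ∧
    Real.exp (-(h * r ^ 2) / 4) * ∫ t in Ioi (0 : ℝ), Real.exp ((z - h) * t) * freeHeatKernel r t ≤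
      ∫ t in Ioi (0 : ℝ), Real.exp (z * t) * landauHeatKernel h r t := by
  have hL := integrableOn_exp_mul_landauHeatKernel hh hr hz
  have hF := integrableOn_exp_mul_freeHeatKernel hr (sub_neg.mpr hz)
  refine ⟨hL, hF, ?_⟩
  rw [← integral_const_mul]
  refine setIntegral_mono_on (hF.const_mul _) hL measurableSet_Ioi fun t ht => ?_
  have h1 : Real.exp ((z - h) * t) = Real.exp (z * t) * Real.exp (-(h * t)) := by
    rw [← Real.exp_add]
    ring_nf
  calc _ = Real.exp (z * t) *
        (Real.exp (-(h * r ^ 2) / 4) * (Real.exp (-(h * t)) * freeHeatKernel r t)) := by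
        rw [h1]; ring
    _ ≤ _ := by
        gcongr
        exact exp_mul_freeHeatKernel_le_landauHeatKernel r hh ht
end

section
/- Fix h₀>0 and R>0. Then there exists E₀>0 with the following property: for every E>E₀ there exists α_E>0 such that for all α∈(0,α_E), all h∈(0,h₀), and all z∈ℂ with Re z<−E₀, the inequality |q(z,h)+α^{−1}| ≤ R·|a(z,h)| implies Re z<−E and |Im z|<4h₀. -/
open MeasureTheory Real Set

/-- `F_h(r,z) = ∫₀^∞ e^{zt} p_h(r,t) dt`, in modulus the Green function of the Landau
Hamiltonian at distance `r`. -/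
noncomputable def landauGreen (h r : ℝ) (z : ℂ) : ℂ :=
  ∫ t in Ioi (0 : ℝ), Complex.exp (z * t) * ((landauHeatKernel h r t : ℝ) : ℂ)

/-- Regularized diagonal value of the free Green function:
`q_0(z) = −(Log(−z) − log 4 + 2γ)/(4π)`. -/
noncomputable def q0 (z : ℂ) : ℂ :=
  -(Complex.log (-z) - Real.log 4 + 2 * Real.eulerMascheroniConstant) / (4 * π)

/-- Regularized diagonal value of the Green function of the Landau Hamiltonian:
`q(z,h) = q_0(z) + ∫₀^∞ e^{zt} (1/(4π))(h/sinh(ht) − 1/t) dt`. -/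
noncomputable def qDiag (h : ℝ) (z : ℂ) : ℂ :=
  q0 z + ∫ t in Ioi (0 : ℝ),
    Complex.exp (z * t) * (((1 / (4 * π)) * (h / Real.sinh (h * t) - 1 / t) : ℝ) : ℂ)

/-- `a(z,h) = 2 F_h(1,z)`, twice the Green function at nearest-neighbour lattice points. -/
noncomputable def aCoeff (h : ℝ) (z : ℂ) : ℂ := 2 * landauGreen h 1 z

lemma sinh_le_mul_cosh {u : ℝ} (hu : 0 ≤ u) : Real.sinh u ≤ u * Real.cosh u := by
  have hmono : MonotoneOn (fun v : ℝ => v * Real.cosh v - Real.sinh v) (Ici 0) := by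
    refine monotoneOn_of_deriv_nonneg (convex_Ici 0) (by fun_prop) (by fun_prop) ?_
    intro v hv
    rw [interior_Ici] at hv
    have hd : HasDerivAt (fun v : ℝ => v * Real.cosh v - Real.sinh v)
        (1 * Real.cosh v + v * Real.sinh v - Real.cosh v) v :=
      ((hasDerivAt_id v).mul (Real.hasDerivAt_cosh v)).sub (Real.hasDerivAt_sinh v)
    rw [hd.deriv, one_mul, add_sub_cancel_left]
    exact mul_nonneg hv.le (Real.sinh_nonneg_iff.2 hv.le)
  simpa using hmono self_mem_Ici hu hu

/-- The Laplace transform of a bounded amplitude decays like the inverse of the decay rate. -/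
lemma norm_setIntegral_exp_mul_le {x C : ℝ} (hx : 0 < x) {z : ℂ} (hz : z.re ≤ -x) {f : ℝ → ℝ}
    (hf : ∀ t > 0, |f t| ≤ C) :
    ‖∫ t in Ioi (0 : ℝ), Complex.exp (z * t) * ((f t : ℝ) : ℂ)‖ ≤ C / x := by
  have hC : 0 ≤ C := (abs_nonneg _).trans (hf 1 one_pos)
  have hint : IntegrableOn (fun t : ℝ => C * Real.exp (-x * t)) (Ioi 0) :=
    (integrableOn_exp_mul_Ioi (neg_neg_of_pos hx) 0).const_mul C
  refine (norm_integral_le_of_norm_le hint ?_).trans_eq ?_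
  · filter_upwards [ae_restrict_mem measurableSet_Ioi] with t ht
    have ht : 0 < t := ht
    rw [norm_mul, Complex.norm_exp, Complex.norm_real, Real.norm_eq_abs, mul_comm C]
    have hre : (z * (t : ℂ)).re ≤ -x * t := by
      simpa using mul_le_mul_of_nonneg_right hz ht.le
    gcongr
    exact hf t ht
  · rw [integral_const_mul, integral_exp_mul_Ioi (neg_neg_of_pos hx) 0]
    simp [div_eq_mul_inv]

/-- If the amplitude is at most linear, its Laplace transform decays quadratically. -/
lemma norm_setIntegral_exp_mul_le_of_linear {x C : ℝ} (hx : 0 < x) {z : ℂ} (hz : z.re ≤ -x)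
    {f : ℝ → ℝ} (hf : ∀ t > 0, |f t| ≤ C * t) :
    ‖∫ t in Ioi (0 : ℝ), Complex.exp (z * t) * ((f t : ℝ) : ℂ)‖ ≤ 4 * C / x ^ 2 := by
  have hC : 0 ≤ C := by simpa using (abs_nonneg _).trans (hf 1 one_pos)
  have hsplit : ∀ t : ℝ, Complex.exp (z * t) * ((f t : ℝ) : ℂ) =
      Complex.exp ((z + (x / 2 : ℝ)) * t) * ((Real.exp (-(x / 2 * t)) * f t : ℝ) : ℂ) := by
    intro t
    push_cast
    rw [← mul_assoc, ← Complex.exp_add]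
    congr 2
    ring
  simp_rw [hsplit]
  refine (norm_setIntegral_exp_mul_le (x := x / 2) (C := 2 * C / x) (half_pos hx) ?_ ?_).trans_eq ?_
  · rw [Complex.add_re, Complex.ofReal_re]
    linarith
  · intro t ht
    rw [abs_mul, abs_of_pos (Real.exp_pos _), Real.exp_neg, inv_mul_le_iff₀ (Real.exp_pos _)]
    refine (hf t ht).trans ?_
    have hexp : x / 2 * t ≤ Real.exp (x / 2 * t) := by
      linarith [Real.add_one_le_exp (x / 2 * t)]
    calc C * t = x / 2 * t * (2 * C / x) := by field_simp
      _ ≤ _ := by gcongr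
  · field_simp
    ring

lemma abs_div_sinh_sub_inv_le {h t : ℝ} (hh : 0 < h) (ht : 0 < t) :
    |h / Real.sinh (h * t) - 1 / t| ≤ h := by
  have hu : 0 < h * t := mul_pos hh ht
  have hs : 0 < Real.sinh (h * t) := Real.sinh_pos_iff.2 hu
  have hsu : h * t ≤ Real.sinh (h * t) := Real.self_le_sinh_iff.2 hu.le
  rw [abs_le]
  constructor
  · have key : Real.sinh (h * t) * (1 - h * t) ≤ h * t := by
      rcases le_or_gt 1 (h * t) with h1 | h1
      · nlinarith
      · have e1 : 1 - h * t ≤ Real.exp (-(h * t)) := by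
          linarith [Real.add_one_le_exp (-(h * t))]
        have e2 : Real.exp (h * t) * (1 - h * t) ≤ 1 := by
          calc _ ≤ Real.exp (h * t) * Real.exp (-(h * t)) := by gcongr
            _ = 1 := by rw [← Real.exp_add]; simp
        rw [Real.sinh_eq]
        nlinarith
    have h2 : 1 / t ≤ h / Real.sinh (h * t) + h := by
      rw [div_add' _ _ _ hs.ne', div_le_div_iff₀ ht hs]
      nlinarith
    linarith
  · have : h / Real.sinh (h * t) ≤ 1 / t := by
      rw [div_le_div_iff₀ hs ht]
      linarith
    linarith

lemma abs_landauHeatKernel_one_le {h t : ℝ} (hh : 0 < h) (ht : 0 < t) :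
    |landauHeatKernel h 1 t| ≤ 8 / π * t := by
  have hu : 0 < h * t := mul_pos hh ht
  have hs : 0 < Real.sinh (h * t) := Real.sinh_pos_iff.2 hu
  have hsu : h * t ≤ Real.sinh (h * t) := Real.self_le_sinh_iff.2 hu.le
  have hπ := Real.pi_pos
  have hpre : h / (4 * π * Real.sinh (h * t)) ≤ 1 / (4 * π * t) := by
    rw [div_le_div_iff₀ (by positivity) (by positivity)]
    nlinarith
  have hcoth : 1 / t ≤ h * (Real.cosh (h * t) / Real.sinh (h * t)) := by
    have : Real.sinh (h * t) ≤ h * t * Real.cosh (h * t) := sinh_le_mul_cosh hu.le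
    rw [mul_div_assoc', div_le_div_iff₀ ht hs]
    linarith
  have hexp : Real.exp (-(h * 1 ^ 2 * (Real.cosh (h * t) / Real.sinh (h * t))) / 4) ≤
      32 * t ^ 2 := by
    have hquad := Real.quadratic_le_exp_of_nonneg (x := 1 / t / 4) (by positivity)
    calc _ ≤ Real.exp (-(1 / t / 4)) := by
          rw [Real.exp_le_exp]
          linarith
      _ = (Real.exp (1 / t / 4))⁻¹ := Real.exp_neg _
      _ ≤ ((1 / t / 4) ^ 2 / 2)⁻¹ := by
          apply inv_anti₀ (by positivity)
          have : 0 < 1 / t / 4 := by positivity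
          linarith
      _ = 32 * t ^ 2 := by field_simp; norm_num
  unfold landauHeatKernel
  rw [abs_of_nonneg (by positivity)]
  calc _ ≤ 1 / (4 * π * t) * (32 * t ^ 2) := by gcongr
    _ = 8 / π * t := by field_simp; norm_num

lemma norm_aCoeff_le {h x : ℝ} (hh : 0 < h) (hx : 0 < x) {z : ℂ} (hz : z.re ≤ -x) :
    4 * π * ‖aCoeff h z‖ ≤ 256 / x ^ 2 := by
  have hb := norm_setIntegral_exp_mul_le_of_linear hx hz
    fun t ht => abs_landauHeatKernel_one_le hh ht
  have hπ := Real.pi_pos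
  rw [aCoeff, norm_mul, Complex.norm_two, landauGreen]
  calc _ ≤ 4 * π * (2 * (4 * (8 / π) / x ^ 2)) := by gcongr
    _ = 256 / x ^ 2 := by field_simp; norm_num

/-- The difference of `q` and its value at zero field, on the scale of the logarithm. -/
lemma norm_qDiag_add_log_le {h x : ℝ} (hh : 0 < h) (hx : 0 < x) {z : ℂ} (hz : z.re ≤ -x) :
    ‖(4 * π : ℝ) * qDiag h z + Complex.log (-z) -
      ((Real.log 4 - 2 * Real.eulerMascheroniConstant : ℝ) : ℂ)‖ ≤ h / x := by
  have hπ := Real.pi_pos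
  have hπ' : (π : ℂ) ≠ 0 := Complex.ofReal_ne_zero.2 hπ.ne'
  have hb := norm_setIntegral_exp_mul_le (C := 1 / (4 * π) * h) hx hz
    (f := fun t => 1 / (4 * π) * (h / Real.sinh (h * t) - 1 / t)) fun t ht => by
      rw [abs_mul, abs_of_pos (by positivity : 0 < 1 / (4 * π))]
      gcongr
      exact abs_div_sinh_sub_inv_le hh ht
  have heq : (4 * π : ℝ) * qDiag h z + Complex.log (-z) -
      ((Real.log 4 - 2 * Real.eulerMascheroniConstant : ℝ) : ℂ) =
      (4 * π : ℝ) * ∫ t in Ioi (0 : ℝ), Complex.exp (z * t) *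
        (((1 / (4 * π)) * (h / Real.sinh (h * t) - 1 / t) : ℝ) : ℂ) := by
    rw [qDiag, q0]
    generalize (∫ t in Ioi (0 : ℝ), Complex.exp (z * t) *
        (((1 / (4 * π)) * (h / Real.sinh (h * t) - 1 / t) : ℝ) : ℂ)) = J
    push_cast
    field_simp
    ring
  rw [heq, norm_mul, Complex.norm_real, Real.norm_of_nonneg (by positivity)]
  calc _ ≤ 4 * π * (1 / (4 * π) * h / x) := by gcongr
    _ = h / x := by field_simp

/-- A complex number whose argument is small is controlled by its real part. -/
lemma norm_and_abs_im_le_of_abs_arg_le {w : ℂ} {θ : ℝ} (hθ : |w.arg| ≤ θ) (hθ' : θ ≤ 1 / 2) :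
    ‖w‖ ≤ 8 / 7 * w.re ∧ |w.im| ≤ 8 / 7 * w.re * θ := by
  have hcos : 7 / 8 ≤ Real.cos w.arg := by
    have := Real.one_sub_sq_div_two_le_cos (x := w.arg)
    nlinarith [sq_abs w.arg, abs_nonneg w.arg]
  have hre := Complex.norm_mul_cos_arg w
  have hnorm : ‖w‖ ≤ 8 / 7 * w.re := by nlinarith [norm_nonneg w]
  refine ⟨hnorm, ?_⟩
  have hsin : |Real.sin w.arg| ≤ θ := Real.abs_sin_le_abs.trans hθ
  rw [← Complex.norm_mul_sin_arg w, abs_mul, abs_norm]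
  have := norm_nonneg w
  gcongr
  linarith

/-- Localization lemma: fix `h₀>0` and `R>0`.  There exists `E₀>0` such that for every
`E>E₀` there is `α_E>0` such that for `α∈(0,α_E)`, `h∈(0,h₀)` and `Re z<−E₀`, the
inequality `|q(z,h)+α⁻¹| ≤ R|a(z,h)|` implies `Re z<−E` and `|Im z|<4h₀`. -/
theorem localization_lemma (h₀ R : ℝ) (hh₀ : 0 < h₀) (hR : 0 < R) :
    ∃ E₀ > 0, ∀ E > E₀, ∃ αE > 0, ∀ α ∈ Ioo (0 : ℝ) αE, ∀ h ∈ Ioo (0 : ℝ) h₀, ∀ z : ℂ,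
      z.re < -E₀ → ‖qDiag h z + ((α⁻¹ : ℝ) : ℂ)‖ ≤ R * ‖aCoeff h z‖ →
        z.re < -E ∧ |z.im| < 4 * h₀ := by
  refine ⟨512 * R / h₀ + 4 * h₀ + 256 * R + 1, by positivity, fun E hE =>
    ⟨(Real.log (2 * E) + 4)⁻¹, ?_, ?_⟩⟩
  · have : 0 < 512 * R / h₀ + 4 * h₀ + 256 * R := by positivity
    have := Real.log_nonneg (x := 2 * E) (by linarith)
    positivity
  rintro α ⟨hα, hαE⟩ h ⟨hh, hhh⟩ z hz hle
  obtain ⟨x, hx⟩ : ∃ x, x = -z.re := ⟨_, rfl⟩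
  have hπ := Real.pi_pos
  have hquot : 0 < 512 * R / h₀ := by positivity
  have hxR : 512 * R / h₀ < x := by nlinarith
  have hxh : 4 * h₀ < x := by nlinarith
  have hx1 : 256 * R + 1 < x := by nlinarith
  have hx0 : 0 < x := by linarith
  have hzx : z.re ≤ -x := by linarith
  have hq := norm_qDiag_add_log_le hh hx0 hzx
  have hw : 4 * π * ‖qDiag h z + ((α⁻¹ : ℝ) : ℂ)‖ ≤ R * (256 / x ^ 2) := by
    have := norm_aCoeff_le hh hx0 hzx
    nlinarith
  have hwx : R * (256 / x ^ 2) ≤ h₀ / 2 / x := by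
    rw [div_lt_iff₀ hh₀] at hxR
    rw [mul_div_assoc', div_le_div_iff₀ (by positivity) hx0]
    nlinarith
  have hsmall : h / x + R * (256 / x ^ 2) ≤ 3 / 2 * h₀ / x := by
    have : h / x ≤ h₀ / x := by gcongr
    calc _ ≤ h₀ / x + h₀ / 2 / x := by linarith
      _ = _ := by ring
  have hθ : 3 / 2 * h₀ / x ≤ 1 / 2 := by
    rw [div_le_div_iff₀ hx0 two_pos]
    linarith
  have hlog : ‖Complex.log (-z) - ((Real.log 4 - 2 * Real.eulerMascheroniConstant +
      4 * π * α⁻¹ : ℝ) : ℂ)‖ ≤ 3 / 2 * h₀ / x := by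
    have heq : Complex.log (-z) - ((Real.log 4 - 2 * Real.eulerMascheroniConstant +
        4 * π * α⁻¹ : ℝ) : ℂ) =
        ((4 * π : ℝ) * qDiag h z + Complex.log (-z) -
          ((Real.log 4 - 2 * Real.eulerMascheroniConstant : ℝ) : ℂ)) -
        (4 * π : ℝ) * (qDiag h z + ((α⁻¹ : ℝ) : ℂ)) := by
      push_cast
      ring
    rw [heq]
    refine (norm_sub_le _ _).trans ?_
    rw [norm_mul, Complex.norm_real, Real.norm_of_nonneg (by positivity : 0 ≤ 4 * π)]
    linarith
  have him := (Complex.abs_im_le_norm _).trans hlog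
  have hre := (Complex.abs_re_le_norm _).trans hlog
  rw [Complex.sub_im, Complex.ofReal_im, sub_zero, Complex.log_im] at him
  rw [Complex.sub_re, Complex.ofReal_re, Complex.log_re] at hre
  obtain ⟨hnorm, himz⟩ := norm_and_abs_im_le_of_abs_arg_le him hθ
  rw [Complex.neg_re, ← hx] at hnorm himz
  rw [Complex.neg_im, abs_neg] at himz
  refine ⟨?_, ?_⟩
  · by_contra! hcon
    have hxE : x ≤ E := by linarith
    have hz0 : 0 < ‖-z‖ := by
      rw [norm_pos_iff, neg_ne_zero]
      rintro rfl
      simp at hx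
      linarith
    have hlogle : Real.log ‖-z‖ ≤ Real.log (2 * E) :=
      Real.log_le_log hz0 (by linarith)
    have hlogE : 0 ≤ Real.log (2 * E) := Real.log_nonneg (by nlinarith)
    have hαinv : Real.log (2 * E) + 4 < α⁻¹ := by
      rwa [lt_inv_comm₀ (by positivity) hα]
    have hlog4 : 0 ≤ Real.log 4 := Real.log_nonneg (by norm_num)
    have hγ := Real.eulerMascheroniConstant_lt_two_thirds
    have := (abs_le.1 hre).1
    nlinarith [Real.pi_gt_three]
  · calc |z.im| ≤ 8 / 7 * x * (3 / 2 * h₀ / x) := himz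
      _ = 12 / 7 * h₀ := by field_simp; norm_num
      _ < 4 * h₀ := by linarith
end
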